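/- Let Σ be a real symmetric positive definite n×n matrix, and let Z ~ N(0,Σ). For every multi-index i and x ∈ ℝⁿ, the Hermite polynomial H̃_i(x,Σ) := H_i(xΣ^{-1}, Σ^{-1}) satisfies H̃_i(x,Σ) = E[(x + iZ)^i], where i on the right denotes the imaginary unit, (x+iZ)^i = Π_k (x_k + i Z_k)^{i_k}, and the expectation is over Z. -/

import Mathlib

open Matrix Real MeasureTheory

noncomputable def pd {n : ℕ} (k : Fin n) (f : (Fin n → ℝ) → ℝ) : (Fin n → ℝ) → ℝ :=
  fun x => fderiv ℝ f x (Pi.single k 1)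

noncomputable def mpd {n : ℕ} (i : Fin n → ℕ) (f : (Fin n → ℝ) → ℝ) : (Fin n → ℝ) → ℝ :=
  (List.finRange n).foldr (fun k h => (pd k)^[i k] h) f

noncomputable def gaussDensity {n : ℕ} (S : Matrix (Fin n) (Fin n) ℝ) (x : Fin n → ℝ) : ℝ :=
  (2 * π) ^ (-(n : ℝ) / 2) * S.det ^ (-(1 : ℝ) / 2) *
    Real.exp (-(1 / 2) * (x ⬝ᵥ S⁻¹.mulVec x))

/-- `H_i(x, Σ) = (-1)^{|i|} (∂^i φ)(x; 0, Σ) / φ(x; 0, Σ)`. -/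
noncomputable def hermiteH {n : ℕ} (S : Matrix (Fin n) (Fin n) ℝ) (i : Fin n → ℕ)
    (x : Fin n → ℝ) : ℝ :=
  (-1 : ℝ) ^ (∑ j, i j) * mpd i (gaussDensity S) x / gaussDensity S x

namespace Matrix.PosDef

variable {n : ℕ} {A : Matrix (Fin n) (Fin n) ℝ}

open scoped ComplexOrder MatrixOrder in
theorem exists_isUnit_transpose_mul_self (hA : A.PosDef) :
    ∃ L : Matrix (Fin n) (Fin n) ℝ, IsUnit L ∧ A = Lᵀ * L := by
  obtain ⟨L, hL, h⟩ := CStarAlgebra.isStrictlyPositive_iff_eq_star_mul_self.mp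
    hA.isStrictlyPositive
  exact ⟨L, hL, by simpa [star_eq_conjTranspose] using h⟩

end Matrix.PosDef

theorem dotProduct_transpose_mul_self_mulVec {n : ℕ} (L : Matrix (Fin n) (Fin n) ℝ)
    (z : Fin n → ℝ) : z ⬝ᵥ (Lᵀ * L).mulVec z = L.mulVec z ⬝ᵥ L.mulVec z := by
  rw [← mulVec_mulVec, dotProduct_mulVec, vecMul_transpose]

theorem sq_norm_le_dotProduct_self {n : ℕ} (u : Fin n → ℝ) : ‖u‖ ^ 2 ≤ u ⬝ᵥ u := by
  have h0 : 0 ≤ u ⬝ᵥ u := Finset.sum_nonneg fun i _ => mul_self_nonneg (u i)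
  rw [← Real.le_sqrt (norm_nonneg _) h0, pi_norm_le_iff_of_nonneg (Real.sqrt_nonneg _)]
  intro i
  refine Real.le_sqrt_of_sq_le ?_
  rw [Real.norm_eq_abs, sq_abs, sq]
  exact Finset.single_le_sum (f := fun i => u i * u i) (fun i _ => mul_self_nonneg (u i))
    (Finset.mem_univ i)

theorem Matrix.PosDef.exists_mul_sq_norm_le {n : ℕ} {A : Matrix (Fin n) (Fin n) ℝ}
    (hA : A.PosDef) : ∃ c > 0, ∀ z : Fin n → ℝ, c * ‖z‖ ^ 2 ≤ z ⬝ᵥ A.mulVec z := by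
  obtain ⟨L, hL, rfl⟩ := hA.exists_isUnit_transpose_mul_self
  set T : (Fin n → ℝ) →L[ℝ] (Fin n → ℝ) := (Matrix.mulVecLin L⁻¹).toContinuousLinearMap
  refine ⟨((‖T‖ + 1) ^ 2)⁻¹, by positivity, fun z => ?_⟩
  rw [dotProduct_transpose_mul_self_mulVec, inv_mul_le_iff₀ (by positivity)]
  have hz : T (L.mulVec z) = z := by
    simp [T, mulVec_mulVec, Matrix.nonsing_inv_mul _ ((isUnit_iff_isUnit_det _).mp hL)]
  calc ‖z‖ ^ 2 ≤ ((‖T‖ + 1) * ‖L.mulVec z‖) ^ 2 := by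
        gcongr
        calc ‖z‖ = ‖T (L.mulVec z)‖ := by rw [hz]
          _ ≤ ‖T‖ * ‖L.mulVec z‖ := T.le_opNorm _
          _ ≤ _ := by gcongr; linarith
    _ = (‖T‖ + 1) ^ 2 * ‖L.mulVec z‖ ^ 2 := mul_pow _ _ _
    _ ≤ _ := by gcongr; exact sq_norm_le_dotProduct_self _

theorem exists_one_add_pow_mul_exp_neg_le {c : ℝ} (hc : 0 < c) (N : ℕ) :
    ∃ C, ∀ t : ℝ, 0 ≤ t → (1 + t) ^ N * Real.exp (-(c * t ^ 2)) ≤ C := by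
  refine ⟨(2 / c) ^ N * (N.factorial * Real.exp c), fun t ht => ?_⟩
  rw [Real.exp_neg, ← div_eq_mul_inv, div_le_iff₀ (Real.exp_pos _)]
  have h := Real.pow_div_factorial_le_exp (c * (1 + t ^ 2)) (by positivity) N
  rw [div_le_iff₀ (by positivity)] at h
  calc (1 + t) ^ N ≤ (2 / c * (c * (1 + t ^ 2))) ^ N := by
        gcongr
        field_simp
        nlinarith [sq_nonneg (t - 1)]
    _ = (2 / c) ^ N * (c * (1 + t ^ 2)) ^ N := mul_pow _ _ _
    _ ≤ (2 / c) ^ N * (Real.exp (c * (1 + t ^ 2)) * N.factorial) := by gcongr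
    _ = _ := by rw [mul_add, Real.exp_add, mul_one]; ring

section GaussDensity

variable {n : ℕ} {S : Matrix (Fin n) (Fin n) ℝ}

theorem gaussDensity_pos (hS : S.PosDef) (x : Fin n → ℝ) : 0 < gaussDensity S x := by
  have := hS.det_pos
  unfold gaussDensity
  positivity

theorem continuous_gaussDensity : Continuous (gaussDensity S) := by
  unfold gaussDensity
  simp only [dotProduct, mulVec]
  fun_prop

theorem integrable_one_add_norm_pow_mul_gaussDensity (hS : S.PosDef) (N : ℕ) :
    Integrable fun z : Fin n → ℝ => (1 + ‖z‖) ^ N * gaussDensity S z := by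
  obtain ⟨c, hc, hcz⟩ := hS.inv.exists_mul_sq_norm_le
  obtain ⟨C, hC⟩ := exists_one_add_pow_mul_exp_neg_le (half_pos hc) (N + (n + 1))
  set K : ℝ := (2 * π) ^ (-(n : ℝ) / 2) * S.det ^ (-(1 : ℝ) / 2) with hK
  have hK0 : 0 ≤ K := by have := hS.det_pos; positivity
  have hint : Integrable fun z : Fin n → ℝ => (1 + ‖z‖) ^ (-((n + 1 : ℕ) : ℝ)) :=
    integrable_one_add_norm (by simp)
  refine (hint.const_mul (K * C)).mono'
    (by have := continuous_gaussDensity (S := S); fun_prop) (.of_forall fun z => ?_)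
  have hg := (gaussDensity_pos hS z).le
  rw [Real.norm_of_nonneg (by positivity), Real.rpow_neg (by positivity), Real.rpow_natCast,
    ← div_eq_mul_inv, le_div_iff₀ (by positivity)]
  calc (1 + ‖z‖) ^ N * gaussDensity S z * (1 + ‖z‖) ^ (n + 1)
      = K * ((1 + ‖z‖) ^ (N + (n + 1)) * Real.exp (-(1 / 2) * (z ⬝ᵥ S⁻¹.mulVec z))) := by
        rw [gaussDensity, pow_add]; ring
    _ ≤ K * ((1 + ‖z‖) ^ (N + (n + 1)) * Real.exp (-(c / 2 * ‖z‖ ^ 2))) := by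
        gcongr
        linarith [hcz z]
    _ ≤ K * C := by gcongr; exact hC _ (norm_nonneg _)

theorem integral_exp_neg_half_dotProduct_self :
    ∫ u : Fin n → ℝ, Real.exp (-(1 / 2) * (u ⬝ᵥ u)) = (2 * π) ^ ((n : ℝ) / 2) := by
  have h (u : Fin n → ℝ) :
      Real.exp (-(1 / 2) * (u ⬝ᵥ u)) = ∏ i, Real.exp (-(1 / 2) * u i ^ 2) := by
    rw [← Real.exp_sum, ← Finset.mul_sum]
    simp [dotProduct, sq]
  simp_rw [h]
  rw [integral_fintype_prod_volume_eq_pow (fun t : ℝ => Real.exp (-(1 / 2) * t ^ 2)),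
    integral_gaussian, Fintype.card_fin, Real.sqrt_eq_rpow, ← Real.rpow_natCast,
    ← Real.rpow_mul (by positivity)]
  congr 1 <;> ring

theorem integral_gaussDensity (hS : S.PosDef) : ∫ z, gaussDensity S z = 1 := by
  obtain ⟨L, hL, h⟩ := hS.inv.exists_isUnit_transpose_mul_self
  have hdet : L.det ≠ 0 := ((isUnit_iff_isUnit_det _).mp hL).ne_zero
  have hSdet : S.det = (L.det ^ 2)⁻¹ := by
    have := congrArg det h
    rw [det_nonsing_inv, det_mul, det_transpose, Ring.inverse_eq_inv'] at this
    rw [← inv_inv S.det, this, sq]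
  have hcomp : ∫ z : Fin n → ℝ, Real.exp (-(1 / 2) * (L.mulVec z ⬝ᵥ L.mulVec z)) =
      |L.det|⁻¹ * (2 * π) ^ ((n : ℝ) / 2) := by
    rw [← integral_exp_neg_half_dotProduct_self]
    have hm := Real.map_matrix_volume_pi_eq_smul_volume_pi hdet
    have hcont : Continuous (Matrix.toLin' L) := (Matrix.toLin' L).continuous_of_finiteDimensional
    have := integral_map (μ := volume) hcont.aemeasurable
      (f := fun u : Fin n → ℝ => Real.exp (-(1 / 2) * (u ⬝ᵥ u)))
      (by simp only [dotProduct]; fun_prop)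
    rw [hm, integral_smul_measure, ENNReal.toReal_ofReal (abs_nonneg _), abs_inv] at this
    simpa using this.symm
  simp only [gaussDensity, h, dotProduct_transpose_mul_self_mulVec]
  rw [integral_const_mul, hcomp, hSdet, ← sq_abs, Real.inv_rpow (by positivity),
    ← Real.rpow_natCast |L.det| 2, ← Real.rpow_mul (abs_nonneg _)]
  have h2 : ((2 : ℕ) : ℝ) * (-1 / 2) = -1 := by norm_num
  rw [h2, Real.rpow_neg_one, inv_inv, neg_div, Real.rpow_neg (by positivity)]
  have : |L.det| ≠ 0 := abs_ne_zero.mpr hdet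
  field_simp

theorem hasFDerivAt_dotProduct_mulVec_self {n : ℕ} (A : Matrix (Fin n) (Fin n) ℝ)
    (x : Fin n → ℝ) :
    HasFDerivAt (fun x : Fin n → ℝ => x ⬝ᵥ A.mulVec x)
      (∑ j, (x j • (ContinuousLinearMap.proj j).comp (Matrix.mulVecLin A).toContinuousLinearMap +
        A.mulVec x j • (ContinuousLinearMap.proj j : (Fin n → ℝ) →L[ℝ] ℝ))) x := by
  refine HasFDerivAt.fun_sum fun j _ => ?_
  exact (ContinuousLinearMap.proj j : (Fin n → ℝ) →L[ℝ] ℝ).hasFDerivAt.mul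
    ((ContinuousLinearMap.proj (R := ℝ) (φ := fun _ : Fin n => ℝ) j).comp
      (Matrix.mulVecLin A).toContinuousLinearMap).hasFDerivAt

theorem differentiable_gaussDensity : Differentiable ℝ (gaussDensity S) := fun x =>
  (((hasFDerivAt_dotProduct_mulVec_self S⁻¹ x).const_mul (-(1 / 2))).exp.const_mul
    _).differentiableAt

theorem fderiv_gaussDensity_apply (hS : S.IsSymm) (x v : Fin n → ℝ) :
    fderiv ℝ (gaussDensity S) x v = -(v ⬝ᵥ S⁻¹.mulVec x) * gaussDensity S x := by
  have h := (((hasFDerivAt_dotProduct_mulVec_self S⁻¹ x).const_mul (-(1 / 2))).exp.const_mul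
    ((2 * π) ^ (-(n : ℝ) / 2) * S.det ^ (-(1 : ℝ) / 2))).fderiv
  have hsymm : x ⬝ᵥ S⁻¹.mulVec v = v ⬝ᵥ S⁻¹.mulVec x := by
    rw [dotProduct_mulVec, ← mulVec_transpose, transpose_nonsing_inv, hS.eq, dotProduct_comm]
  have hsum : ∑ j, (x j * S⁻¹.mulVec v j + S⁻¹.mulVec x j * v j) =
      2 * (v ⬝ᵥ S⁻¹.mulVec x) := by
    rw [Finset.sum_add_distrib, two_mul]
    exact congrArg₂ _ hsymm (dotProduct_comm _ _)
  have h' : fderiv ℝ (gaussDensity S) x = _ := h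
  rw [h']
  simp only [_root_.smul_apply, _root_.sum_apply,
    _root_.add_apply, ContinuousLinearMap.comp_apply, ContinuousLinearMap.proj_apply,
    LinearMap.coe_toContinuousLinearMap', Matrix.mulVecLin_apply, smul_eq_mul, hsum, gaussDensity]
  ring

end GaussDensity

namespace Function.HasTemperateGrowth

variable {E F : Type*} [NormedAddCommGroup E] [NormedSpace ℝ E] [NormedAddCommGroup F]
  [NormedSpace ℝ F] {f : E → F}

theorem exists_norm_le_and_norm_fderiv_le (hf : f.HasTemperateGrowth) :
    ∃ (k : ℕ) (C : ℝ), 0 ≤ C ∧ ∀ x, ‖f x‖ ≤ C * (1 + ‖x‖) ^ k ∧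
      ‖fderiv ℝ f x‖ ≤ C * (1 + ‖x‖) ^ k := by
  obtain ⟨k, C, hC, h⟩ := hf.norm_iteratedFDeriv_le_uniform 1
  refine ⟨k, C, hC, fun x => ⟨by simpa using h 0 zero_le_one x, ?_⟩⟩
  rw [← norm_iteratedFDeriv_one]
  exact h 1 le_rfl x

theorem comp_prodMk_left {D : Type*} [NormedAddCommGroup D] [NormedSpace ℝ D]
    {f : D × E → F} (hf : f.HasTemperateGrowth) (y : D) :
    (fun z => f (y, z)).HasTemperateGrowth := by
  have h : (fun z : E => ((y, 0) : D × E) + ContinuousLinearMap.inr ℝ D E z).HasTemperateGrowth :=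
    by fun_prop
  simpa [Function.comp_def] using hf.comp h

theorem finset_prod {ι R : Type*} [NormedCommRing R] [NormedAlgebra ℝ R] {f : ι → E → R}
    (s : Finset ι) (hf : ∀ i ∈ s, (f i).HasTemperateGrowth) :
    (fun x => ∏ i ∈ s, f i x).HasTemperateGrowth := by
  classical
  induction s using Finset.induction_on with
  | empty => simp [HasTemperateGrowth.const]
  | insert a s has ih =>
    simp only [Finset.prod_insert has]
    exact (hf a (by simp)).mul (ih fun i hi => hf i (by simp [hi]))

end Function.HasTemperateGrowth

section GaussianIntegrals

variable {n : ℕ} {S : Matrix (Fin n) (Fin n) ℝ} {F : Type*} [NormedAddCommGroup F]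
  [NormedSpace ℝ F]

theorem integrable_gaussDensity_smul (hS : S.PosDef) {f : (Fin n → ℝ) → F} (hf : Continuous f)
    {k : ℕ} {C : ℝ} (h : ∀ z, ‖f z‖ ≤ C * (1 + ‖z‖) ^ k) :
    Integrable fun z => gaussDensity S z • f z := by
  refine ((integrable_one_add_norm_pow_mul_gaussDensity hS k).const_mul C).mono'
    (continuous_gaussDensity.smul hf).aestronglyMeasurable (.of_forall fun z => ?_)
  rw [norm_smul, Real.norm_of_nonneg (gaussDensity_pos hS z).le]
  calc gaussDensity S z * ‖f z‖ ≤ gaussDensity S z * (C * (1 + ‖z‖) ^ k) := by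
        gcongr
        exacts [(gaussDensity_pos hS z).le, h z]
    _ = _ := by ring

theorem Function.HasTemperateGrowth.integrable_gaussDensity_smul (hS : S.PosDef)
    {f : (Fin n → ℝ) → F} (hf : f.HasTemperateGrowth) :
    Integrable fun z => gaussDensity S z • f z := by
  obtain ⟨k, C, -, h⟩ := hf.exists_norm_le_and_norm_fderiv_le
  exact _root_.integrable_gaussDensity_smul hS hf.1.continuous fun z => (h z).1

/-- Gaussian integration by parts. -/
theorem integral_gaussDensity_smul_fderiv (hS : S.PosDef) {f : (Fin n → ℝ) → F}
    (hf : f.HasTemperateGrowth) (v : Fin n → ℝ) :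
    ∫ z, gaussDensity S z • fderiv ℝ f z v =
      ∫ z, gaussDensity S z • (v ⬝ᵥ S⁻¹.mulVec z) • f z := by
  have hsymm : S.IsSymm := by simpa using hS.isHermitian
  let T : (Fin n → ℝ) →L[ℝ] ℝ := ((dotProductBilin ℝ ℝ v).comp
    (Matrix.mulVecLin S⁻¹)).toContinuousLinearMap
  have hT : (fun z => T z • f z).HasTemperateGrowth := T.hasTemperateGrowth.smul hf
  have hTint := hT.integrable_gaussDensity_smul hS
  have hD (z : Fin n → ℝ) : fderiv ℝ (gaussDensity S) z v • f z =
      -(gaussDensity S z • (v ⬝ᵥ S⁻¹.mulVec z) • f z) := by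
    rw [fderiv_gaussDensity_apply hsymm, smul_smul, ← neg_smul]
    ring_nf
  obtain ⟨k, C, -, h⟩ := hf.exists_norm_le_and_norm_fderiv_le
  rw [integral_smul_fderiv_eq_neg_fderiv_smul_of_integrable]
  · simp_rw [hD, integral_neg, neg_neg]
  · simp_rw [hD]
    exact hTint.neg
  · refine integrable_gaussDensity_smul hS (k := k) (C := C * ‖v‖)
      ((hf.1.continuous_fderiv (by simp)).clm_apply continuous_const) fun z => ?_
    calc ‖fderiv ℝ f z v‖ ≤ ‖fderiv ℝ f z‖ * ‖v‖ := ContinuousLinearMap.le_opNorm _ _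
      _ ≤ C * (1 + ‖z‖) ^ k * ‖v‖ := by gcongr; exact (h z).2
      _ = _ := by ring
  · exact hf.integrable_gaussDensity_smul hS
  · exact fun z _ => differentiable_gaussDensity z
  · exact fun z _ => hf.1.differentiable (by simp) z

/-- Differentiation under a Gaussian integral. -/
theorem hasFDerivAt_integral_gaussDensity_smul (hS : S.PosDef) [CompleteSpace F]
    {E : Type*} [NormedAddCommGroup E] [NormedSpace ℝ E]
    {q : E × (Fin n → ℝ) → F} (hq : q.HasTemperateGrowth) (y : E) :
    ∃ D : E →L[ℝ] F, HasFDerivAt (fun y => ∫ z, gaussDensity S z • q (y, z)) D y ∧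
      ∀ v, D v = ∫ z, gaussDensity S z • fderiv ℝ q (y, z) (v, 0) := by
  obtain ⟨k, C, hC, h⟩ := hq.exists_norm_le_and_norm_fderiv_le
  let q' (y : E) (z : Fin n → ℝ) : E →L[ℝ] F :=
    (fderiv ℝ q (y, z)).comp (ContinuousLinearMap.inl ℝ E (Fin n → ℝ))
  have hq'cont : Continuous (q' y) :=
    ((hq.1.continuous_fderiv (by simp)).comp (Continuous.prodMk_right y)).clm_comp
      continuous_const
  have hq'bound (x : E) (hx : x ∈ Metric.ball y 1) (z : Fin n → ℝ) :
      ‖q' x z‖ ≤ C * (2 + ‖y‖) ^ k * (1 + ‖z‖) ^ k := by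
    have hx' : ‖x‖ ≤ ‖y‖ + 1 := by
      have := norm_le_norm_add_norm_sub' x y
      rw [mem_ball_iff_norm] at hx
      linarith
    have hxz : 1 + ‖(x, z)‖ ≤ (2 + ‖y‖) * (1 + ‖z‖) := by
      have : ‖(x, z)‖ ≤ ‖x‖ + ‖z‖ := by
        rw [Prod.norm_def]
        exact max_le_add_of_nonneg (norm_nonneg _) (norm_nonneg _)
      nlinarith [norm_nonneg y, norm_nonneg z, mul_nonneg (norm_nonneg y) (norm_nonneg z)]
    calc ‖q' x z‖ ≤ ‖fderiv ℝ q (x, z)‖ * ‖ContinuousLinearMap.inl ℝ E (Fin n → ℝ)‖ :=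
          ContinuousLinearMap.opNorm_comp_le _ _
      _ ≤ ‖fderiv ℝ q (x, z)‖ * 1 := by
          gcongr
          exact ContinuousLinearMap.norm_inl_le_one ℝ E (Fin n → ℝ)
      _ ≤ C * ((2 + ‖y‖) * (1 + ‖z‖)) ^ k := by
          rw [mul_one]
          refine (h (x, z)).2.trans ?_
          gcongr
      _ = _ := by rw [mul_pow]; ring
  have hq'int : Integrable fun z => gaussDensity S z • q' y z :=
    integrable_gaussDensity_smul hS hq'cont (hq'bound y (Metric.mem_ball_self one_pos))
  refine ⟨∫ z, gaussDensity S z • q' y z, ?_, fun v => ?_⟩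
  · refine hasFDerivAt_integral_of_dominated_of_fderiv_le
      (F' := fun x z => gaussDensity S z • q' x z)
      (bound := fun z => C * (2 + ‖y‖) ^ k * ((1 + ‖z‖) ^ k * gaussDensity S z))
      (Metric.ball_mem_nhds y one_pos) (.of_forall fun x => ?_)
      ((hq.comp_prodMk_left y).integrable_gaussDensity_smul hS) hq'int.aestronglyMeasurable
      (.of_forall fun z x hx => ?_)
      ((integrable_one_add_norm_pow_mul_gaussDensity hS k).const_mul _)
      (.of_forall fun z x _ => ?_)
    · exact ((hq.comp_prodMk_left x).integrable_gaussDensity_smul hS).aestronglyMeasurable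
    · have hg := (gaussDensity_pos hS z).le
      rw [norm_smul, Real.norm_of_nonneg hg, ← mul_assoc, mul_comm]
      gcongr
      exact hq'bound x hx z
    · exact (((hq.1.differentiable (by simp) (x, z)).hasFDerivAt.comp x
        (hasFDerivAt_prodMk_left x z))).const_smul _
  · rw [ContinuousLinearMap.integral_apply hq'int]
    simp [q']

end GaussianIntegrals

section ComplexMoments

variable {n : ℕ}

/-- The monomial `((S y) + i z)^m` as a function of the pair `(y, z)`. -/
noncomputable def complexMonomial (S : Matrix (Fin n) (Fin n) ℝ) (m : Fin n → ℕ)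
    (p : (Fin n → ℝ) × (Fin n → ℝ)) : ℂ :=
  ∏ j, ((S.mulVec p.1 j : ℂ) + Complex.I * (p.2 j : ℂ)) ^ m j

theorem complexMonomial_hasTemperateGrowth (S : Matrix (Fin n) (Fin n) ℝ) (m : Fin n → ℕ) :
    (complexMonomial S m).HasTemperateGrowth := by
  refine Function.HasTemperateGrowth.finset_prod _ fun j _ => ?_
  refine Function.HasTemperateGrowth.pow ?_ _
  let T : (Fin n → ℝ) × (Fin n → ℝ) →L[ℝ] ℝ := (ContinuousLinearMap.proj j).comp
    ((Matrix.mulVecLin S).toContinuousLinearMap.comp (ContinuousLinearMap.fst ℝ _ _))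
  let U : (Fin n → ℝ) × (Fin n → ℝ) →L[ℝ] ℝ :=
    (ContinuousLinearMap.proj j).comp (ContinuousLinearMap.snd ℝ _ _)
  exact (Complex.ofRealCLM.comp T).hasTemperateGrowth.add
    ((Function.HasTemperateGrowth.const Complex.I).mul
      (Complex.ofRealCLM.comp U).hasTemperateGrowth)

theorem differentiable_complexMonomial (S : Matrix (Fin n) (Fin n) ℝ) (m : Fin n → ℕ) :
    Differentiable ℝ (complexMonomial S m) :=
  (complexMonomial_hasTemperateGrowth S m).1.differentiable (by simp)

theorem fderiv_complexMonomial_snd (S : Matrix (Fin n) (Fin n) ℝ) (m : Fin n → ℕ)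
    (y z v : Fin n → ℝ) :
    fderiv ℝ (complexMonomial S m) (y, z) (0, S.mulVec v) =
      Complex.I * fderiv ℝ (complexMonomial S m) (y, z) (v, 0) := by
  let h (τ : ℂ) : ℂ :=
    ∏ j, ((S.mulVec y j : ℂ) + Complex.I * (z j : ℂ) + τ * (S.mulVec v j : ℂ)) ^ m j
  have hh : Differentiable ℂ h := by fun_prop
  have h1 : HasDerivAt (fun t : ℝ => h t) (deriv h 0) 0 := by
    simpa using (hh ((0 : ℝ) : ℂ)).hasDerivAt.comp_ofReal
  have h2 : HasDerivAt (fun t : ℝ => h (Complex.I * t)) (Complex.I * deriv h 0) 0 := by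
    have := ((hh (Complex.I * ((0 : ℝ) : ℂ))).hasDerivAt.comp _
      ((hasDerivAt_id ((0 : ℝ) : ℂ)).const_mul Complex.I)).comp_ofReal
    simpa [mul_comm] using this
  have hd := (differentiable_complexMonomial S m (y, z)).hasFDerivAt
  have h1' := hd.hasLineDerivAt (v, 0)
  have h2' := hd.hasLineDerivAt (0, S.mulVec v)
  have e1 : (fun t : ℝ => complexMonomial S m ((y, z) + t • (v, 0))) = fun t : ℝ => h t := by
    funext t
    refine Finset.prod_congr rfl fun j _ => ?_
    simp [mulVec_add, mulVec_smul]
    ring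
  have e2 : (fun t : ℝ => complexMonomial S m ((y, z) + t • (0, S.mulVec v))) =
      fun t : ℝ => h (Complex.I * t) := by
    funext t
    refine Finset.prod_congr rfl fun j _ => ?_
    simp
    ring
  rw [HasLineDerivAt, e1] at h1'
  rw [HasLineDerivAt, e2] at h2'
  rw [h2'.unique h2, h1'.unique h1]

/-- The complex moment `E[(S y + i Z)^m]` for `Z ∼ N(0, S)`. -/
noncomputable def complexMoment (S : Matrix (Fin n) (Fin n) ℝ) (m : Fin n → ℕ)
    (y : Fin n → ℝ) : ℂ :=
  ∫ z, gaussDensity S z • complexMonomial S m (y, z)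

theorem complexMonomial_add_single (S : Matrix (Fin n) (Fin n) ℝ) (m : Fin n → ℕ) (k : Fin n)
    (p : (Fin n → ℝ) × (Fin n → ℝ)) :
    complexMonomial S (m + Pi.single k 1) p =
      ((S.mulVec p.1 k : ℂ) + Complex.I * (p.2 k : ℂ)) * complexMonomial S m p := by
  simp only [complexMonomial, Pi.add_apply, pow_add, Finset.prod_mul_distrib]
  rw [mul_comm, Finset.prod_eq_single k (fun j _ hj => by simp [hj]) (by simp)]
  simp

variable {S : Matrix (Fin n) (Fin n) ℝ}

theorem exists_hasFDerivAt_complexMoment (hS : S.PosDef) (m : Fin n → ℕ) (y : Fin n → ℝ) :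
    ∃ D : (Fin n → ℝ) →L[ℝ] ℂ, HasFDerivAt (complexMoment S m) D y ∧ ∀ k,
      D (Pi.single k 1) =
        S.mulVec y k * complexMoment S m y - complexMoment S (m + Pi.single k 1) y := by
  obtain ⟨D, hD, hDv⟩ :=
    hasFDerivAt_integral_gaussDensity_smul hS (complexMonomial_hasTemperateGrowth S m) y
  refine ⟨D, hD, fun k => ?_⟩
  have hunit : IsUnit S.det := (isUnit_iff_isUnit_det _).mp hS.isUnit
  have hsymm : S.IsSymm := by simpa using hS.isHermitian
  have hq := (complexMonomial_hasTemperateGrowth S m).comp_prodMk_left y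
  have hparts := integral_gaussDensity_smul_fderiv hS hq (S.mulVec (Pi.single k 1))
  have hcoord (z : Fin n → ℝ) : S.mulVec (Pi.single k 1) ⬝ᵥ S⁻¹.mulVec z = z k := by
    rw [dotProduct_mulVec, ← vecMul_transpose, vecMul_vecMul, hsymm.eq,
      Matrix.mul_nonsing_inv _ hunit, vecMul_one, single_one_dotProduct]
  have hfd (z : Fin n → ℝ) :
      fderiv ℝ (fun z => complexMonomial S m (y, z)) z (S.mulVec (Pi.single k 1)) =
        Complex.I * fderiv ℝ (complexMonomial S m) (y, z) (Pi.single k 1, 0) := by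
    have : HasFDerivAt (fun z => complexMonomial S m (y, z)) _ z :=
      (differentiable_complexMonomial S m (y, z)).hasFDerivAt.comp z (hasFDerivAt_prodMk_right y z)
    rw [this.fderiv, ← fderiv_complexMonomial_snd]
    simp
  simp_rw [hcoord, hfd, ← mul_smul_comm] at hparts
  rw [integral_const_mul, ← hDv] at hparts
  have hZ : (fun z : Fin n → ℝ => z k • complexMonomial S m (y, z)).HasTemperateGrowth :=
    (ContinuousLinearMap.proj (R := ℝ) (φ := fun _ : Fin n => ℝ) k).hasTemperateGrowth.smul hq
  have hmom : complexMoment S (m + Pi.single k 1) y = S.mulVec y k * complexMoment S m y +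
      Complex.I * ∫ z, gaussDensity S z • z k • complexMonomial S m (y, z) := by
    rw [complexMoment, complexMoment, ← integral_const_mul, ← integral_const_mul,
      ← integral_add ((hq.integrable_gaussDensity_smul hS).const_mul _)
        ((hZ.integrable_gaussDensity_smul hS).const_mul _)]
    refine integral_congr_ae (.of_forall fun z => ?_)
    simp only [complexMonomial_add_single, Complex.real_smul]
    ring
  rw [hmom, ← hparts, ← mul_assoc, Complex.I_mul_I]
  ring

theorem complexMoment_zero (hS : S.PosDef) (y : Fin n → ℝ) : complexMoment S 0 y = 1 := by
  simp [complexMoment, complexMonomial, integral_complex_ofReal, integral_gaussDensity hS]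

theorem ofReal_pd_eq (hS : S.PosDef) {m : Fin n → ℕ} {f : (Fin n → ℝ) → ℝ}
    (hf : ∀ y, (f y : ℂ) = (-1) ^ (∑ j, m j) * (gaussDensity S⁻¹ y * complexMoment S m y))
    (k : Fin n) (y : Fin n → ℝ) :
    (pd k f y : ℂ) = (-1) ^ (∑ j, (m + Pi.single k 1 : Fin n → ℕ) j) *
      (gaussDensity S⁻¹ y * complexMoment S (m + Pi.single k 1) y) := by
  obtain ⟨D, hD, hDk⟩ := exists_hasFDerivAt_complexMoment hS m y
  have hsymm : S⁻¹.IsSymm := by simpa using hS.inv.isHermitian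
  have hG := Complex.ofRealCLM.hasFDerivAt.comp y
    (differentiable_gaussDensity (S := S⁻¹) y).hasFDerivAt
  have hprod := (hG.mul hD).const_mul ((-1 : ℂ) ^ (∑ j, m j))
  have hfC : HasFDerivAt (fun y => (f y : ℂ)) _ y := hprod.congr_of_eventuallyEq (.of_forall hf)
  have hfR : HasFDerivAt f _ y := Complex.reCLM.hasFDerivAt.comp y hfC
  have hfC' : HasFDerivAt (fun y => (f y : ℂ)) _ y :=
    Complex.ofRealCLM.hasFDerivAt.comp y hfR.differentiableAt.hasFDerivAt
  have huniq := congrArg (fun T : (Fin n → ℝ) →L[ℝ] ℂ => T (Pi.single k 1)) (hfC'.unique hfC)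
  have hsum : ∑ j, (m + Pi.single k 1 : Fin n → ℕ) j = ∑ j, m j + 1 := by
    simp [Finset.sum_add_distrib]
  have hinv : (S⁻¹)⁻¹ = S :=
    Matrix.nonsing_inv_nonsing_inv _ ((isUnit_iff_isUnit_det _).mp hS.isUnit)
  have hGk := fderiv_gaussDensity_apply hsymm y (Pi.single k 1)
  rw [hinv, single_one_dotProduct] at hGk
  simp only [ContinuousLinearMap.comp_apply, _root_.smul_apply, _root_.add_apply, hDk, hGk,
    Complex.ofRealCLM_apply, smul_eq_mul, Function.comp_apply] at huniq
  rw [pd, huniq, hsum, pow_succ]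
  push_cast
  ring

theorem ofReal_iterate_pd_eq (hS : S.PosDef) {m : Fin n → ℕ} {f : (Fin n → ℝ) → ℝ}
    (hf : ∀ y, (f y : ℂ) = (-1) ^ (∑ j, m j) * (gaussDensity S⁻¹ y * complexMoment S m y))
    (k : Fin n) (N : ℕ) (y : Fin n → ℝ) :
    ((pd k)^[N] f y : ℂ) = (-1) ^ (∑ j, (m + Pi.single k N : Fin n → ℕ) j) *
      (gaussDensity S⁻¹ y * complexMoment S (m + Pi.single k N) y) := by
  induction N generalizing y with
  | zero => simpa using hf y
  | succ N ih =>
    rw [Function.iterate_succ_apply', ofReal_pd_eq hS ih, add_assoc, ← Pi.single_add]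

theorem ofReal_mpd_gaussDensity_inv (hS : S.PosDef) (m : Fin n → ℕ) (y : Fin n → ℝ) :
    (mpd m (gaussDensity S⁻¹) y : ℂ) =
      (-1) ^ (∑ j, m j) * (gaussDensity S⁻¹ y * complexMoment S m y) := by
  have key (l : List (Fin n)) (y : Fin n → ℝ) :
      (l.foldr (fun k h => (pd k)^[m k] h) (gaussDensity S⁻¹) y : ℂ) =
        (-1) ^ (∑ j, (l.map fun k => Pi.single k (m k)).sum j) *
          (gaussDensity S⁻¹ y * complexMoment S (l.map fun k => Pi.single k (m k)).sum y) := by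
    induction l generalizing y with
    | nil => simp [complexMoment_zero hS]
    | cons k l ih =>
      rw [List.foldr_cons, ofReal_iterate_pd_eq hS ih, List.map_cons, List.sum_cons, add_comm]
  have hm : ((List.finRange n).map fun k => Pi.single k (m k)).sum = m := by
    rw [← List.ofFn_eq_map, List.sum_ofFn, Finset.univ_sum_single]
  rw [mpd, key, hm]

end ComplexMoments

/-- For `Σ` real symmetric positive definite and `Z ∼ N(0, Σ)`, the Hermite polynomial
`H̃_i(x, Σ) := H_i(x Σ⁻¹, Σ⁻¹)` equals the complex Gaussian moment `E[(x + i Z)^i]`,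
where `(x + iZ)^i = ∏_k (x_k + i Z_k)^{i_k}` with `i` the imaginary unit. -/
theorem stmt11 {n : ℕ} (S : Matrix (Fin n) (Fin n) ℝ) (hS : S.PosDef)
    (i : Fin n → ℕ) (x : Fin n → ℝ) :
    (hermiteH S⁻¹ i (Matrix.vecMul x S⁻¹) : ℂ) =
      ∫ z : Fin n → ℝ,
        (∏ k, ((x k : ℂ) + Complex.I * (z k : ℂ)) ^ i k) * (gaussDensity S z : ℂ) := by
  have hsymm : S⁻¹.IsSymm := by simpa using hS.inv.isHermitian
  have hx : S.mulVec (Matrix.vecMul x S⁻¹) = x := by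
    rw [← mulVec_transpose, hsymm.eq, mulVec_mulVec,
      Matrix.mul_nonsing_inv _ ((isUnit_iff_isUnit_det _).mp hS.isUnit), one_mulVec]
  have hG : (gaussDensity S⁻¹ (Matrix.vecMul x S⁻¹) : ℂ) ≠ 0 :=
    Complex.ofReal_ne_zero.mpr (gaussDensity_pos hS.inv _).ne'
  have hsign : (-1 : ℂ) ^ (∑ j, i j) * (-1) ^ (∑ j, i j) = 1 := by
    rw [← mul_pow]; simp
  rw [hermiteH]
  push_cast
  rw [ofReal_mpd_gaussDensity_inv hS, ← mul_assoc, hsign, one_mul, mul_div_cancel_left₀ _ hG]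
  simp only [complexMoment, complexMonomial, hx, Complex.real_smul, mul_comm]
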